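/- (Hadamard bound) For any $n \times n$ real matrix $A$, the absolute value of the determinant is bounded by the product of the Euclidean norms of its columns: $|\det(A)| \leq \prod_{j=1}^{n} \left( \sum_{i=1}^{n} A_{ij}^2 \right)^{1/2}$. -/

import Mathlib

/-- Hadamard bound: `|det A|` is at most the product of the Euclidean norms of the columns. -/
theorem abs_det_le_prod_column_norms {n : ℕ} (A : Matrix (Fin n) (Fin n) ℝ) :
    |A.det| ≤ ∏ j, Real.sqrt (∑ i, (A i j) ^ 2) := by
  have : Fact (Module.finrank ℝ (EuclideanSpace ℝ (Fin n)) = n) := ⟨by simp⟩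
  let b := EuclideanSpace.basisFun (Fin n) ℝ
  let v : Fin n → EuclideanSpace ℝ (Fin n) := fun j => WithLp.toLp 2 (fun i => A i j)
  have h := b.toBasis.orientation.abs_volumeForm_apply_le v
  rw [Orientation.volumeForm_robust' _ b, Module.Basis.det_apply] at h
  have hA : b.toBasis.toMatrix v = A := by
    ext i j
    simp [b, v, Module.Basis.toMatrix_apply]
  rw [hA] at h
  simpa [v, EuclideanSpace.norm_eq] using h
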